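/- For all integers n ≥ 1 and 0 ≤ m ≤ n, the weight space {v ∈ Cₙ : H·v = (n − 2m)·v} of the sl₂(ℂ)-module Cₙ ⊆ V^⊗n has complex dimension S(n,m). Equivalently, S(n,m) = binom(n,m) − N(n,m), where N(n,m) is the number of cyclic-rotation orbits of binary words of length n with exactly m ones. -/

import Mathlib

open scoped TensorProduct

noncomputable section

/-- V = ℂ². -/
abbrev V2 : Type := Fin 2 → ℂ

/-- The basis vectors e₁ = `bvec 0`, e₂ = `bvec 1` of V = ℂ². -/
def bvec (j : Fin 2) : V2 := Pi.single j 1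

/-- The matrix of H : H·e₁ = −e₁, H·e₂ = e₂. -/
def Hmat : Matrix (Fin 2) (Fin 2) ℂ := !![-1, 0; 0, 1]

/-- The matrix of E : E·e₁ = e₂, E·e₂ = 0. -/
def Emat : Matrix (Fin 2) (Fin 2) ℂ := !![0, 0; 1, 0]

/-- The matrix of F : F·e₂ = e₁, F·e₁ = 0. -/
def Fmat : Matrix (Fin 2) (Fin 2) ℂ := !![0, 1; 0, 0]

/-- The action of a matrix `g` on the `n`-fold tensor power of V = ℂ² by derivations:
`g·(v₁⊗⋯⊗vₙ) = Σᵢ v₁⊗⋯⊗(g·vᵢ)⊗⋯⊗vₙ`. -/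
def derivAction (n : ℕ) (g : Matrix (Fin 2) (Fin 2) ℂ) :
    (⨂[ℂ] _ : Fin n, V2) →ₗ[ℂ] ⨂[ℂ] _ : Fin n, V2 :=
  ∑ i : Fin n, PiTensorProduct.map
    (Function.update (fun _ : Fin n => (LinearMap.id : V2 →ₗ[ℂ] V2)) i g.mulVecLin)

/-- `Cyc n` : the subspace Cₙ ⊆ V^⊗n spanned by all `v₁⊗…⊗vₙ − v₂⊗…⊗vₙ⊗v₁`. -/
def Cyc (n : ℕ) : Submodule ℂ (⨂[ℂ] _ : Fin n, V2) :=
  Submodule.span ℂ {x | ∃ v : Fin n → V2,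
    x = PiTensorProduct.tprod ℂ v -
        PiTensorProduct.tprod ℂ (fun i => v (finRotate n i))}

/-- S(n,m) := Σ_{ℓ | n, n | ℓm} ((ℓ−1)/ℓ)·Σ_{k | gcd(ℓ, ℓm/n)} μ(k)·binom(ℓ/k, ℓm/(kn)),
where μ is the Möbius function. -/
def S (n m : ℕ) : ℚ :=
  ∑ ℓ ∈ n.divisors.filter (fun ℓ => n ∣ ℓ * m),
    (((ℓ : ℚ) - 1) / (ℓ : ℚ)) *
      ∑ k ∈ (Nat.gcd ℓ (ℓ * m / n)).divisors,
        ((ArithmeticFunction.moebius k : ℤ) : ℚ) * ((ℓ / k).choose (ℓ * m / (k * n)) : ℚ)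

/-- N(n,m): the number of cyclic-rotation orbits of binary words of length n with
exactly m ones. -/
def NOrb (n m : ℕ) : ℕ :=
  Nat.card (Quot fun u v : {w : Fin n → Fin 2 // Nat.card {i : Fin n // w i = 1} = m} =>
    (fun i => u.val (finRotate n i)) = v.val)

section Orbits

variable {α : Type*} {f : α → α}

open Function

theorem exists_iterate_eq_of_quot_mk_eq (hf : ∀ x, x ∈ periodicPts f) {x y : α}
    (h : Quot.mk (fun u v => f u = v) x = Quot.mk (fun u v => f u = v) y) :
    ∃ k, f^[k] x = y := by
  have h' := Quot.eqvGen_exact h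
  clear h
  induction h' with
  | rel x y h => exact ⟨1, h⟩
  | refl x => exact ⟨0, rfl⟩
  | symm x y _ ih =>
    obtain ⟨k, rfl⟩ := ih
    obtain ⟨p, hp, hx⟩ := hf x
    refine ⟨p * k - k, ?_⟩
    rw [← iterate_add_apply, Nat.sub_add_cancel (Nat.le_mul_of_pos_left k hp)]
    exact hx.mul_const k
  | trans x y z _ _ ih₁ ih₂ =>
    obtain ⟨k, rfl⟩ := ih₁
    obtain ⟨l, rfl⟩ := ih₂
    exact ⟨l + k, iterate_add_apply f l k x⟩

theorem quot_mk_iterate (x : α) (k : ℕ) :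
    Quot.mk (fun u v => f u = v) (f^[k] x) = Quot.mk (fun u v => f u = v) x := by
  induction k with
  | zero => rfl
  | succ k ih => rw [iterate_succ_apply', ← ih]; exact (Quot.sound (r := fun u v => f u = v) rfl).symm

/-- The number of orbits of a self-map all of whose points are periodic is the sum of the
reciprocals of the orbit sizes. -/
theorem card_quot_eq_sum_inv_minimalPeriod [Fintype α] (hf : ∀ x, x ∈ periodicPts f) :
    (Nat.card (Quot fun u v => f u = v) : ℚ) = ∑ x, (minimalPeriod f x : ℚ)⁻¹ := by
  classical
  let π : α → Quot fun u v => f u = v := Quot.mk _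
  have : Finite (Quot fun u v => f u = v) := Quot.finite _
  let _ := Fintype.ofFinite (Quot fun u v => f u = v)
  rw [← Finset.sum_fiberwise Finset.univ π, Nat.card_eq_fintype_card, Fintype.card_eq_sum_ones,
    Nat.cast_sum]
  refine Finset.sum_congr rfl fun q _ => ?_
  obtain ⟨x, rfl⟩ := Quot.exists_rep q
  have hp := minimalPeriod_pos_of_mem_periodicPts (hf x)
  have key : Finset.univ.filter (fun y => π y = Quot.mk _ x) =
      (Finset.range (minimalPeriod f x)).image (fun k => f^[k] x) := by
    ext y
    simp only [Finset.mem_filter, Finset.mem_univ, true_and, Finset.mem_image, Finset.mem_range]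
    constructor
    · intro h
      obtain ⟨k, rfl⟩ := exists_iterate_eq_of_quot_mk_eq hf h.symm
      exact ⟨k % minimalPeriod f x, Nat.mod_lt _ hp, iterate_mod_minimalPeriod_eq⟩
    · rintro ⟨k, -, rfl⟩
      exact quot_mk_iterate x k
  rw [key, Finset.sum_image (by
    intro a ha b hb h
    exact iterate_injOn_Iio_minimalPeriod (by simpa using ha) (by simpa using hb) h)]
  simp only [minimalPeriod_apply_iterate (hf x), Finset.sum_const, Finset.card_range, nsmul_eq_mul]
  rw [mul_inv_cancel₀ (by exact_mod_cast hp.ne')]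
  simp

/-- The number of points of minimal period `l`, by Möbius inversion. -/
theorem card_minimalPeriod_eq_sum_moebius [Fintype α] [DecidableEq α] {l : ℕ} (hl : 0 < l) :
    (Nat.card {x // minimalPeriod f x = l} : ℚ) = ∑ k ∈ l.divisors,
      ((ArithmeticFunction.moebius k : ℤ) : ℚ) * (Nat.card {x // f^[l / k] x = x} : ℚ) := by
  have key := (ArithmeticFunction.sum_eq_iff_sum_mul_moebius_eq (R := ℚ)
    (f := fun l => (Nat.card {x // minimalPeriod f x = l} : ℚ))
    (g := fun d => (Nat.card {x // f^[d] x = x} : ℚ))).1 (by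
      intro d hd
      simp only [Nat.card_eq_fintype_card, Fintype.card_subtype]
      rw [← Nat.cast_sum, Finset.card_eq_sum_card_fiberwise (f := minimalPeriod f)
        (t := d.divisors)]
      · congr 1
        refine Finset.sum_congr rfl fun i hi => ?_
        congr 1
        ext x
        simp only [Finset.mem_filter, Finset.mem_univ, true_and]
        constructor
        · rintro rfl
          exact ⟨isPeriodicPt_iff_minimalPeriod_dvd.2 (Nat.dvd_of_mem_divisors hi), rfl⟩
        · exact fun h => h.2
      · intro x hx
        have hx' : IsPeriodicPt f d x := (Finset.mem_filter.1 hx).2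
        simpa using ⟨hx'.minimalPeriod_dvd, hd.ne'⟩) l hl
  rw [← key]
  exact Nat.sum_divisorsAntidiagonal (fun a b => ((ArithmeticFunction.moebius a : ℤ) : ℚ) *
    (Nat.card {x // f^[b] x = x} : ℚ))

/-- Points minus orbits, for a self-map whose `n`-th iterate is the identity. -/
theorem card_sub_card_quot [Fintype α] {n : ℕ} (hn : 0 < n) (hf : ∀ x, f^[n] x = x) :
    (Nat.card α : ℚ) - Nat.card (Quot fun u v => f u = v) = ∑ l ∈ n.divisors,
      (((l : ℚ) - 1) / l) * (Nat.card {x // minimalPeriod f x = l} : ℚ) := by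
  classical
  have hper : ∀ x, x ∈ periodicPts f := fun x => ⟨n, hn, hf x⟩
  rw [card_quot_eq_sum_inv_minimalPeriod hper, Nat.card_eq_fintype_card,
    Fintype.card_eq_sum_ones, Nat.cast_sum, ← Finset.sum_sub_distrib,
    ← Finset.sum_fiberwise_of_maps_to (t := n.divisors) (g := minimalPeriod f)
      (fun x _ => Nat.mem_divisors.2 ⟨IsPeriodicPt.minimalPeriod_dvd (hf x), hn.ne'⟩)]
  refine Finset.sum_congr rfl fun l hl => ?_
  have hl0 : (l : ℚ) ≠ 0 := by exact_mod_cast (Nat.pos_of_mem_divisors hl).ne'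
  rw [Finset.sum_congr rfl (g := fun _ => ((l : ℚ) - 1) / l)]
  · rw [Finset.sum_const, nsmul_eq_mul, mul_comm, Nat.card_eq_fintype_card, Fintype.card_subtype]
  · intro x hx
    rw [(Finset.mem_filter.1 hx).2]
    field_simp
    simp

end Orbits

section Words

/-- Binary words of length `n` with exactly `m` ones. -/
abbrev BinaryWord (n m : ℕ) : Type :=
  {w : Fin n → Fin 2 // Nat.card {i : Fin n // w i = 1} = m}

theorem card_ones_rotate {n : ℕ} (w : Fin n → Fin 2) :
    Nat.card {i : Fin n // w (finRotate n i) = 1} = Nat.card {i : Fin n // w i = 1} :=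
  Nat.card_congr ((finRotate n).subtypeEquiv fun _ => Iff.rfl)

/-- Cyclic rotation of binary words. -/
def rotateWord (n m : ℕ) (w : BinaryWord n m) : BinaryWord n m :=
  ⟨fun i => w.1 (finRotate n i), (card_ones_rotate w.1).trans w.2⟩

theorem card_quot_rotateWord (n m : ℕ) :
    Nat.card (Quot fun u v => rotateWord n m u = v) = NOrb n m := by
  have h : (fun u v => rotateWord n m u = v) =
      fun u v : BinaryWord n m => (fun i => u.val (finRotate n i)) = v.val := by
    funext u v
    exact propext Subtype.ext_iff
  rw [h]
  rfl

theorem card_binaryWord (n m : ℕ) : Nat.card (BinaryWord n m) = n.choose m := by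
  classical
  have e : BinaryWord n m ≃ {s : Finset (Fin n) // s.card = m} :=
    { toFun := fun w => ⟨Finset.univ.filter (fun i => w.1 i = 1), by
        rw [← Fintype.card_subtype, ← Nat.card_eq_fintype_card, w.2]⟩
      invFun := fun s => ⟨fun i => if i ∈ s.1 then 1 else 0, by
        rw [Nat.card_eq_fintype_card, Fintype.card_subtype]
        simpa using s.2⟩
      left_inv := fun w => by
        ext i
        have : w.1 i = 0 ∨ w.1 i = 1 := by omega
        rcases this with h | h <;> simp [h]
      right_inv := fun s => by ext i; simp }
  rw [Nat.card_congr e, Nat.card_eq_fintype_card, Fintype.card_finset_len, Fintype.card_fin]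

theorem val_iterate_finRotate {n : ℕ} (i : Fin n) (k : ℕ) :
    (((finRotate n)^[k] i : Fin n) : ℕ) = (i + k) % n := by
  induction k with
  | zero => simp [Nat.mod_eq_of_lt i.2]
  | succ k ih =>
    have := i.neZero
    rw [Function.iterate_succ_apply', finRotate_apply, Fin.val_add, ih]
    simp [Nat.add_assoc]

theorem rotateWord_iterate_apply {n m : ℕ} (k : ℕ) (w : BinaryWord n m) (i : Fin n) :
    ((rotateWord n m)^[k] w).1 i = w.1 ((finRotate n)^[k] i) := by
  induction k generalizing i with
  | zero => rfl
  | succ k ih =>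
    rw [Function.iterate_succ_apply', Function.iterate_succ_apply]
    exact ih _

theorem rotateWord_iterate_self {n m : ℕ} (w : BinaryWord n m) : (rotateWord n m)^[n] w = w := by
  refine Subtype.ext (funext fun i => ?_)
  rw [rotateWord_iterate_apply]
  refine congrArg w.1 (Fin.ext ?_)
  rw [val_iterate_finRotate, Nat.add_mod_right, Nat.mod_eq_of_lt i.2]

theorem card_ones_repeat (e d : ℕ) (u : Fin d → Fin 2) :
    Nat.card {i : Fin (e * d) // u i.modNat = 1} = e * Nat.card {j : Fin d // u j = 1} := by
  rw [Nat.card_congr (β := Fin e × {j : Fin d // u j = 1}), Nat.card_prod, Nat.card_fin]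
  exact
    { toFun := fun i => (i.1.divNat, ⟨i.1.modNat, i.2⟩)
      invFun := fun p => ⟨finProdFinEquiv (p.1, p.2.1), by
        have := congrArg Prod.snd (finProdFinEquiv.symm_apply_apply (p.1, p.2.1))
        simp only [finProdFinEquiv_symm_apply] at this
        rw [this]; exact p.2.2⟩
      left_inv := fun i => Subtype.ext (finProdFinEquiv.apply_symm_apply i.1)
      right_inv := fun p => by
        have := finProdFinEquiv.symm_apply_apply (p.1, p.2.1)
        simp only [finProdFinEquiv_symm_apply, Prod.mk.injEq] at this
        exact Prod.ext this.1 (Subtype.ext this.2) }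

/-- A word fixed by the `d`-th rotation, `d` dividing its length, is a repeated word. -/
theorem rotateWord_fixed_iff {e d m : ℕ} (he : 0 < e) (w : BinaryWord (e * d) m) :
    (rotateWord (e * d) m)^[d] w = w ↔
      ∀ i : Fin (e * d),
        w.1 i = w.1 ⟨i.modNat, i.modNat.2.trans_le (Nat.le_mul_of_pos_left d he)⟩ := by
  constructor
  · intro h i
    have h2 : (rotateWord (e * d) m)^[d * i.divNat] w = w := by
      rw [Function.iterate_mul]
      exact Function.iterate_fixed h _
    conv_rhs => rw [← h2]
    rw [rotateWord_iterate_apply]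
    refine congrArg w.1 (Fin.ext ?_)
    rw [val_iterate_finRotate]
    simp only [Fin.coe_modNat, Fin.coe_divNat]
    rw [Nat.mod_add_div, Nat.mod_eq_of_lt i.2]
  · intro h
    refine Subtype.ext (funext fun i => ?_)
    rw [rotateWord_iterate_apply, h, h i]
    refine congrArg w.1 (Fin.ext ?_)
    rw [Fin.val_mk, Fin.val_mk, Fin.coe_modNat, Fin.coe_modNat, val_iterate_finRotate,
      Nat.mod_mod_of_dvd _ (Nat.dvd_mul_left d e), Nat.add_mod_right]

theorem card_fixed_rotateWord {e d m : ℕ} (he : 0 < e) :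
    Nat.card {w : BinaryWord (e * d) m // (rotateWord (e * d) m)^[d] w = w} =
      if e ∣ m then d.choose (m / e) else 0 := by
  have key : Nat.card {w : BinaryWord (e * d) m // (rotateWord (e * d) m)^[d] w = w} =
      Nat.card {u : Fin d → Fin 2 // e * Nat.card {j : Fin d // u j = 1} = m} := by
    refine Nat.card_congr
      { toFun := fun w => ⟨fun j => w.1.1 ⟨j, j.2.trans_le (Nat.le_mul_of_pos_left d he)⟩, ?_⟩
        invFun := fun u => ⟨⟨fun i => u.1 i.modNat, (card_ones_repeat e d u.1).trans u.2⟩, ?_⟩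
        left_inv := fun w => ?_
        right_inv := fun u => ?_ }
    · have h := (rotateWord_fixed_iff he w.1).1 w.2
      rw [← card_ones_repeat]
      refine Eq.trans ?_ w.1.2
      refine Nat.card_congr (Equiv.subtypeEquivRight fun i => ?_)
      rw [h i]
    · rw [rotateWord_fixed_iff he]
      intro i
      refine congrArg u.1 (Fin.ext ?_)
      simp
    · exact Subtype.ext (Subtype.ext (funext fun i => ((rotateWord_fixed_iff he w.1).1 w.2 i).symm))
    · refine Subtype.ext (funext fun j => congrArg u.1 (Fin.ext ?_))
      simp [Nat.mod_eq_of_lt j.2]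
  rw [key]
  split_ifs with h
  · obtain ⟨t, rfl⟩ := h
    rw [Nat.mul_div_cancel_left t he, ← card_binaryWord]
    exact Nat.card_congr (Equiv.subtypeEquivRight fun u => by
      rw [Nat.mul_right_inj he.ne'])
  · have : IsEmpty {u : Fin d → Fin 2 // e * Nat.card {j : Fin d // u j = 1} = m} :=
      ⟨fun u => h ⟨_, u.2.symm⟩⟩
    exact Nat.card_of_isEmpty

theorem card_minimalPeriod_rotateWord {n m l : ℕ} (hn : 0 < n) (hl : l ∣ n) :
    (Nat.card {w // Function.minimalPeriod (rotateWord n m) w = l} : ℚ) =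
      if n ∣ l * m then ∑ k ∈ (Nat.gcd l (l * m / n)).divisors,
        ((ArithmeticFunction.moebius k : ℤ) : ℚ) * ((l / k).choose (l * m / (k * n)) : ℚ)
      else 0 := by
  classical
  have hl0 : 0 < l := Nat.pos_of_dvd_of_pos hl hn
  rw [card_minimalPeriod_eq_sum_moebius hl0]
  have fixed : ∀ k ∈ l.divisors,
      Nat.card {w // (rotateWord n m)^[l / k] w = w} =
        if n * k ∣ l * m then (l / k).choose (l * m / (k * n)) else 0 := by
    intro k hk
    obtain ⟨d, rfl⟩ := Nat.dvd_of_mem_divisors hk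
    obtain ⟨c, rfl⟩ := hl
    have hk0 : 0 < k := Nat.pos_of_mul_pos_right hl0
    have hd0 : 0 < d := Nat.pos_of_mul_pos_left hl0
    have hc0 : 0 < c := Nat.pos_of_mul_pos_left hn
    rw [Nat.mul_div_cancel_left d hk0, show k * d * c = (k * c) * d by ring,
      card_fixed_rotateWord (Nat.mul_pos hk0 hc0)]
    have h1 : k * c * d * k ∣ k * d * m ↔ k * c ∣ m := by
      rw [show k * c * d * k = (k * d) * (k * c) by ring]
      exact Nat.mul_dvd_mul_iff_left hl0
    have h2 : k * d * m / (k * (k * c * d)) = m / (k * c) := by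
      rw [show k * (k * c * d) = (k * d) * (k * c) by ring, Nat.mul_div_mul_left _ _ hl0]
    rw [h2]
    simp only [h1]
  rw [Finset.sum_congr rfl fun k hk => by rw [fixed k hk]]
  split_ifs with h
  · obtain ⟨t, ht⟩ := h
    have hsub : (Nat.gcd l (l * m / n)).divisors ⊆ l.divisors :=
      Nat.divisors_subset_of_dvd hl0.ne' (Nat.gcd_dvd_left _ _)
    rw [← Finset.sum_subset hsub]
    · refine Finset.sum_congr rfl fun k hk => ?_
      have h3 : k ∣ l * m / n := (Nat.dvd_of_mem_divisors hk).trans (Nat.gcd_dvd_right _ _)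
      rw [ht, Nat.mul_div_cancel_left t hn] at h3
      rw [if_pos (ht ▸ Nat.mul_dvd_mul_left n h3)]
    · intro k hk hk'
      rw [if_neg]
      · simp
      · intro h3
        apply hk'
        rw [ht] at h3
        refine Nat.mem_divisors.2 ⟨Nat.dvd_gcd (Nat.dvd_of_mem_divisors hk) ?_,
          Nat.gcd_ne_zero_left hl0.ne'⟩
        rw [ht, Nat.mul_div_cancel_left t hn]
        exact (Nat.mul_dvd_mul_iff_left hn).1 h3
  · refine Finset.sum_eq_zero fun k _ => ?_
    rw [if_neg fun h3 => h ((Nat.dvd_mul_right n k).trans h3)]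
    simp

theorem S_eq_choose_sub_NOrb (n m : ℕ) (hn : 1 ≤ n) :
    S n m = (n.choose m : ℚ) - (NOrb n m : ℚ) := by
  classical
  rw [← card_binaryWord, ← card_quot_rotateWord, card_sub_card_quot hn rotateWord_iterate_self, S,
    Finset.sum_filter]
  refine Finset.sum_congr rfl fun l hl => ?_
  rw [card_minimalPeriod_rotateWord hn (Nat.dvd_of_mem_divisors hl)]
  split_ifs <;> simp

end Words

section Coinvariants

variable {K α : Type*} [Field K] (f : α → α)

/-- A finitely supported function has zero sum along each class of the relation generated by
`f x ~ x` only if it is a combination of the differences `x - f x`. -/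
theorem ker_lmapDomain_quot_le :
    LinearMap.ker (Finsupp.lmapDomain K K (Quot.mk fun u v => f u = v)) ≤
      Submodule.span K (Set.range fun x => Finsupp.single x (1 : K) - Finsupp.single (f x) 1) := by
  set D := Submodule.span K (Set.range fun x => Finsupp.single x (1 : K) - Finsupp.single (f x) 1)
  have hrel : ∀ x y, Relation.EqvGen (fun u v => f u = v) x y →
      Finsupp.single x (1 : K) - Finsupp.single y 1 ∈ D := by
    intro x y h
    induction h with
    | rel x y h => exact Submodule.subset_span ⟨x, by simp [h]⟩
    | refl x => simp
    | symm x y _ ih => rw [← neg_sub]; exact D.neg_mem ih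
    | trans x y z _ _ ih₁ ih₂ =>
      rw [← sub_add_sub_cancel _ (Finsupp.single y 1)]; exact D.add_mem ih₁ ih₂
  intro g hg
  have hg' : Finsupp.mapDomain (Quot.mk fun u v => f u = v) g = 0 := hg
  have hout : Finsupp.mapDomain (fun x => (Quot.mk (fun u v => f u = v) x).out) g = 0 := by
    rw [← Function.comp_def Quot.out, Finsupp.mapDomain_comp, hg', Finsupp.mapDomain_zero]
  have hsum : g = g.sum fun x c => c • (Finsupp.single x (1 : K) -
      Finsupp.single (Quot.mk (fun u v => f u = v) x).out 1) := by
    simp only [smul_sub, Finsupp.smul_single, smul_eq_mul, mul_one]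
    rw [Finsupp.sum_sub, Finsupp.sum_single]
    change g = g - Finsupp.mapDomain (fun x => (Quot.mk (fun u v => f u = v) x).out) g
    rw [hout, sub_zero]
  rw [hsum]
  refine D.sum_mem fun x _ => D.smul_mem _ (hrel _ _ (Quot.eqvGen_exact ?_))
  exact (Quot.out_eq _).symm

theorem finrank_ker_lmapDomain_quot [Finite α] :
    (Module.finrank K (LinearMap.ker (Finsupp.lmapDomain K K (Quot.mk fun u v => f u = v))) : ℚ) =
      Nat.card α - Nat.card (Quot fun u v => f u = v) := by
  have := Fintype.ofFinite α
  have : Finite (Quot fun u v => f u = v) := Quot.finite _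
  have := Fintype.ofFinite (Quot fun u v => f u = v)
  have h := (Finsupp.lmapDomain K K (Quot.mk fun u v => f u = v)).finrank_range_add_finrank_ker
  rw [LinearMap.range_eq_top.2 (Finsupp.mapDomain_surjective Quot.mk_surjective), finrank_top,
    Module.finrank_finsupp_self, Module.finrank_finsupp_self] at h
  rw [Nat.card_eq_fintype_card, Nat.card_eq_fintype_card, ← h]
  push_cast
  ring

end Coinvariants

theorem ker_sub_smul_id_eq_span {ι K M : Type*} [Field K] [AddCommGroup M] [Module K M]
    (b : Module.Basis ι K M) (D : M →ₗ[K] M) (c : ι → K) (hD : ∀ i, D (b i) = c i • b i) (μ : K) :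
    LinearMap.ker (D - μ • LinearMap.id) = Submodule.span K (b '' {i | c i = μ}) := by
  apply le_antisymm
  · intro x hx
    have hcoord : ∀ i, (b.coord i) ∘ₗ D = c i • b.coord i := by
      intro i
      refine b.ext fun j => ?_
      by_cases h : j = i
      · subst h; simp [hD]
      · simp [hD, h]
    have hx' : D x = μ • x := by simpa [sub_eq_zero] using hx
    refine b.mem_span_image.2 fun i hi => ?_
    have h := LinearMap.congr_fun (hcoord i) x
    simp only [LinearMap.comp_apply, hx', map_smul, LinearMap.smul_apply, smul_eq_mul,
      Module.Basis.coord_apply] at h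
    exact (mul_right_cancel₀ (Finsupp.mem_support_iff.1 hi) h).symm
  · rw [Submodule.span_le]
    rintro _ ⟨i, hi, rfl⟩
    have hi' : c i = μ := hi
    simp [hD, hi']

section WordBasis

/-- The basis `e₂, e₁` of `V2`, ordered so that the index counts the weight downwards. -/
def weightBasis : Module.Basis (Fin 2) ℂ V2 :=
  (Pi.basisFun ℂ (Fin 2)).reindex (Equiv.swap 0 1)

theorem mulVecLin_Hmat_weightBasis (j : Fin 2) :
    Hmat.mulVecLin (weightBasis j) = (1 - 2 * (if j = 1 then 1 else 0) : ℂ) • weightBasis j := by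
  fin_cases j <;> ext i <;> fin_cases i <;>
    simp [weightBasis, Hmat, Matrix.mulVec, dotProduct]; norm_num

/-- The basis of `V^⊗n` indexed by binary words. -/
def wordBasis (n : ℕ) : Module.Basis (Fin n → Fin 2) ℂ (⨂[ℂ] _ : Fin n, V2) :=
  Basis.piTensorProduct fun _ => weightBasis

theorem wordBasis_apply (n : ℕ) (w : Fin n → Fin 2) :
    wordBasis n w = PiTensorProduct.tprod ℂ fun i => weightBasis (w i) :=
  Basis.piTensorProduct_apply _ w

theorem derivAction_Hmat_wordBasis (n : ℕ) (w : Fin n → Fin 2) :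
    derivAction n Hmat (wordBasis n w) =
      ((n : ℂ) - 2 * (Nat.card {i : Fin n // w i = 1} : ℕ)) • wordBasis n w := by
  classical
  have h : ∀ i : Fin n, PiTensorProduct.map
      (Function.update (fun _ : Fin n => (LinearMap.id : V2 →ₗ[ℂ] V2)) i Hmat.mulVecLin)
      (wordBasis n w) = (1 - 2 * (if w i = 1 then 1 else 0) : ℂ) • wordBasis n w := by
    intro i
    rw [wordBasis_apply, PiTensorProduct.map_tprod]
    have hv : (fun j => Function.update (fun _ : Fin n => (LinearMap.id : V2 →ₗ[ℂ] V2)) i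
        Hmat.mulVecLin j (weightBasis (w j))) =
        Function.update (fun j => weightBasis (w j)) i
          ((1 - 2 * (if w i = 1 then 1 else 0) : ℂ) • weightBasis (w i)) := by
      funext j
      by_cases hj : j = i
      · subst hj
        rw [Function.update_self, Function.update_self, mulVecLin_Hmat_weightBasis]
      · rw [Function.update_of_ne hj, Function.update_of_ne hj]
        rfl
    rw [hv, MultilinearMap.map_update_smul, Function.update_eq_self]
  rw [derivAction, LinearMap.sum_apply, Finset.sum_congr rfl fun i _ => h i, ← Finset.sum_smul,
    Finset.sum_sub_distrib, ← Finset.mul_sum, Finset.sum_boole, Nat.card_eq_fintype_card,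
    Fintype.card_subtype]
  simp

/-- The linear map sending a formal combination of words with `m` ones to the tensor power. -/
def wordEmbedding (n m : ℕ) : (BinaryWord n m →₀ ℂ) →ₗ[ℂ] ⨂[ℂ] _ : Fin n, V2 :=
  Finsupp.linearCombination ℂ fun w => wordBasis n w.1

theorem wordEmbedding_single (n m : ℕ) (w : BinaryWord n m) :
    wordEmbedding n m (Finsupp.single w 1) = wordBasis n w.1 := by
  simp [wordEmbedding]

theorem wordEmbedding_injective (n m : ℕ) : Function.Injective (wordEmbedding n m) :=
  (wordBasis n).linearIndependent.comp _ Subtype.val_injective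

theorem range_wordEmbedding (n m : ℕ) : LinearMap.range (wordEmbedding n m) =
    LinearMap.ker (derivAction n Hmat - ((n : ℂ) - 2 * m) • LinearMap.id) := by
  rw [ker_sub_smul_id_eq_span _ _ _ (derivAction_Hmat_wordBasis n), wordEmbedding,
    Finsupp.range_linearCombination]
  congr 1
  ext x
  simp

/-- The projection of the tensor power to formal combinations of rotation classes of words with
`m` ones. -/
def classProjection (n m : ℕ) : (⨂[ℂ] _ : Fin n, V2) →ₗ[ℂ]
    ((Quot fun u v => rotateWord n m u = v) →₀ ℂ) := by
  classical
  exact (wordBasis n).constr ℂ fun w =>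
    if h : Nat.card {i : Fin n // w i = 1} = m then Finsupp.single (Quot.mk _ ⟨w, h⟩) 1 else 0

theorem classProjection_wordBasis_rotate (n m : ℕ) (w : Fin n → Fin 2) :
    classProjection n m (wordBasis n fun i => w (finRotate n i)) =
      classProjection n m (wordBasis n w) := by
  rw [classProjection, Module.Basis.constr_basis, Module.Basis.constr_basis]
  simp only [card_ones_rotate]
  split_ifs with h
  · congr 1
    exact (Quot.sound (r := fun u v => rotateWord n m u = v) (a := ⟨w, h⟩) rfl).symm
  · rfl

theorem Cyc_le_ker_classProjection (n m : ℕ) : Cyc n ≤ LinearMap.ker (classProjection n m) := by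
  rw [Cyc, Submodule.span_le]
  rintro _ ⟨v, rfl⟩
  let R : (⨂[ℂ] _ : Fin n, V2) →ₗ[ℂ] ⨂[ℂ] _ : Fin n, V2 :=
    (PiTensorProduct.reindex ℂ (fun _ => V2) (finRotate n).symm).toLinearMap
  have hR : ∀ v : Fin n → V2, R (PiTensorProduct.tprod ℂ v) =
      PiTensorProduct.tprod ℂ fun i => v (finRotate n i) :=
    fun v => PiTensorProduct.reindex_tprod _ v
  have hP : classProjection n m ∘ₗ R = classProjection n m := by
    refine (wordBasis n).ext fun w => ?_
    rw [← classProjection_wordBasis_rotate n m w, LinearMap.comp_apply, wordBasis_apply, hR,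
      wordBasis_apply]
  rw [SetLike.mem_coe, LinearMap.mem_ker, map_sub, sub_eq_zero, ← hR]
  exact (LinearMap.congr_fun hP _).symm

theorem classProjection_comp_wordEmbedding (n m : ℕ) :
    classProjection n m ∘ₗ wordEmbedding n m =
      Finsupp.lmapDomain ℂ ℂ (Quot.mk fun u v => rotateWord n m u = v) := by
  refine Finsupp.lhom_ext' fun w => LinearMap.ext_ring ?_
  simp only [LinearMap.comp_apply, Finsupp.lsingle_apply, wordEmbedding_single,
    Finsupp.lmapDomain_apply, Finsupp.mapDomain_single]
  rw [classProjection, Module.Basis.constr_basis, dif_pos w.2]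

theorem comap_wordEmbedding_Cyc (n m : ℕ) : (Cyc n).comap (wordEmbedding n m) =
    LinearMap.ker (Finsupp.lmapDomain ℂ ℂ (Quot.mk fun u v => rotateWord n m u = v)) := by
  apply le_antisymm
  · intro x hx
    rw [← classProjection_comp_wordEmbedding]
    exact Cyc_le_ker_classProjection n m hx
  · refine (ker_lmapDomain_quot_le _).trans (Submodule.span_le.2 ?_)
    rintro _ ⟨w, rfl⟩
    rw [SetLike.mem_coe, Submodule.mem_comap, map_sub, wordEmbedding_single, wordEmbedding_single,
      wordBasis_apply, wordBasis_apply]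
    exact Submodule.subset_span ⟨_, rfl⟩

theorem finrank_Cyc_weightSpace (n m : ℕ) :
    (Module.finrank ℂ
      ↥(Cyc n ⊓ LinearMap.ker (derivAction n Hmat - ((n : ℂ) - 2 * m) • LinearMap.id)) : ℚ) =
      (n.choose m : ℚ) - (NOrb n m : ℚ) := by
  rw [← range_wordEmbedding, inf_comm, ← Submodule.map_comap_eq, comap_wordEmbedding_Cyc,
    ← (Submodule.equivMapOfInjective _ (wordEmbedding_injective n m) _).finrank_eq,
    finrank_ker_lmapDomain_quot, card_binaryWord, card_quot_rotateWord]

end WordBasis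

/-!
STATEMENT 7: for n ≥ 1 and 0 ≤ m ≤ n, the weight space
{v ∈ Cₙ : H·v = (n − 2m)·v} has complex dimension S(n,m); equivalently
S(n,m) = binom(n,m) − N(n,m).  The weight space is the intersection of Cₙ with
the kernel of (H-action) − (n−2m)·id.
-/
theorem stmt_7 (n m : ℕ) (hn : 1 ≤ n) (hm : m ≤ n) :
    (Module.finrank ℂ
      ↥(Cyc n ⊓ LinearMap.ker (derivAction n Hmat - ((n : ℂ) - 2 * m) • LinearMap.id))
        : ℚ) = S n m ∧
    S n m = (n.choose m : ℚ) - (NOrb n m : ℚ) := by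
  have hS := S_eq_choose_sub_NOrb n m hn
  exact ⟨(finrank_Cyc_weightSpace n m).trans hS.symm, hS⟩
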